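/- Let f : S → ℂ be a non-zero solution of the equation ∫_S f(σ(y)xt) dμ(t) − ∫_S f(xyt) dμ(t) = 2 f(x) f(y) for all x, y ∈ S, and define g(x) := (∫_S f(xt) dμ(t)) / (∫_S f(t) dμ(t)). Then the pair (f, g) satisfies the sine addition law f(xy) = f(x) g(y) + f(y) g(x) for all x, y ∈ S. -/

import Mathlib

/-- If `F (σ y * x) - F (x * y) = 2 * f x * f y`, then `f` is odd under the involution `σ`. -/
theorem odd_of_vanVleck {S : Type*} [Semigroup S] {σ : S → S} (hinv : ∀ x : S, σ (σ x) = x)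
    {f F : S → ℂ} (hE : ∀ x y, F (σ y * x) - F (x * y) = 2 * f x * f y) (x : S) :
    f (σ x) = -f x := by
  have h1 := hE x x
  have h2 := hE x (σ x)
  have h3 := hE (σ x) (σ x)
  have h4 := hE (σ x) x
  rw [hinv] at h2 h3
  have h : (f x + f (σ x)) ^ 2 = 0 := by
    linear_combination (-1 / 2 : ℂ) * (h1 + h2 + h3 + h4)
  linear_combination pow_eq_zero_iff (two_ne_zero) |>.mp h

/-- If `F (σ y * x) - F (x * y) = 2 * f x * f y` with `f` non-zero, then `F` is not odd under the
involutive morphism `σ`. -/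
theorem not_odd_of_vanVleck {S : Type*} [Semigroup S] {σ : S → S}
    (hmor : (∀ x y : S, σ (x * y) = σ x * σ y) ∨ (∀ x y : S, σ (x * y) = σ y * σ x))
    (hinv : ∀ x : S, σ (σ x) = x) {f F : S → ℂ}
    (hE : ∀ x y, F (σ y * x) - F (x * y) = 2 * f x * f y) {w : S} (hw : f w ≠ 0) :
    ¬ ∀ x, F (σ x) = -F x := by
  intro hF
  have hodd := odd_of_vanVleck hinv hE
  have h1 := hE w w
  have h2 := hE w (σ w)
  have h3 := hE (σ w) (σ w)
  have h4 := hE (σ w) w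
  rw [hinv] at h2 h3
  rw [hodd] at h2 h3 h4
  have k1 := hF (w * w)
  have k2 := hF (σ w * w)
  have k3 := hF (w * σ w)
  have h : f w * f w = 0 := by
    rcases hmor with hm | hm <;> simp only [hm, hinv] at k1 k2 k3
    all_goals grind
  exact hw (mul_self_eq_zero.mp h)

theorem stmt9 {S : Type*} [Semigroup S] (σ : S → S)
    (hmor : (∀ x y : S, σ (x * y) = σ x * σ y) ∨ (∀ x y : S, σ (x * y) = σ y * σ x))
    (hinv : ∀ x : S, σ (σ x) = x)
    {I : Type*} [Fintype I] (c : I → ℂ) (z : I → S)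
    (hcen : ∀ i : I, ∀ s : S, z i * s = s * z i)
    (f : S → ℂ) (hf : f ≠ 0)
    (heq : ∀ x y : S, (∑ i, c i * f (σ y * x * z i)) - (∑ i, c i * f (x * y * z i))
      = 2 * f x * f y) 
    (g : S → ℂ)
    (hg : ∀ x : S, g x = (∑ i, c i * f (x * z i)) / (∑ i, c i * f (z i))) :
    ∀ x y : S, f (x * y) = f x * g y + f y * g x := by
  obtain ⟨w, hw⟩ := Function.ne_iff.mp hf
  change f w ≠ 0 at hw
  obtain ⟨F, hFdef⟩ : ∃ F : S → ℂ, ∀ x, F x = ∑ i, c i * f (x * z i) := ⟨_, fun _ => rfl⟩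
  obtain ⟨m, hm⟩ : ∃ m : ℂ, m = ∑ i, c i * f (z i) := ⟨_, rfl⟩
  simp only [← hFdef, ← hm] at heq hg
  have hodd := odd_of_vanVleck hinv heq
  have hnot := not_odd_of_vanVleck hmor hinv heq hw
  have hcen' : ∀ i s, σ (z i) * s = s * σ (z i) := by
    intro i s
    have h := congrArg σ (hcen i (σ s))
    rcases hmor with hσ | hσ <;> simp only [hσ, hinv] at h
    exacts [h, h.symm]
  have key : ∀ x y, m * f (σ y * x) = f x * F y - F x * f y := by
    intro x y
    have h : ∀ j, f (σ y * x) * f (z j) = f x * f (y * z j) - f (x * z j) * f y := by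
      intro j
      have h1 := heq (x * z j) y
      have h2 := heq x (y * z j)
      have h3 := heq (σ y * x) (z j)
      have e1 : σ (y * z j) * x = σ (z j) * (σ y * x) := by
        rcases hmor with hσ | hσ <;> rw [hσ]
        · rw [← hcen', mul_assoc]
        · rw [mul_assoc]
      have e2 : x * z j * y = x * (y * z j) := by rw [mul_assoc, hcen]
      rw [e2, ← mul_assoc] at h1
      rw [e1] at h2
      linear_combination (1 / 2 : ℂ) * (h2 - h1 - h3)
    rw [hm, hFdef, hFdef, Finset.sum_mul, Finset.sum_mul, Finset.mul_sum,
      ← Finset.sum_sub_distrib]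
    exact Finset.sum_congr rfl fun j _ => by linear_combination c j * h j
  have hm0 : m ≠ 0 := by
    rintro rfl
    refine hnot fun x => mul_left_cancel₀ hw ?_
    have h1 := key w x
    have h2 := key w (σ x)
    rw [hodd] at h2
    linear_combination -h1 - h2
  have key' : ∀ x y, m * f (y * x) = f x * F (σ y) + F x * f y := by
    intro x y
    have h := key x (σ y)
    rw [hinv, hodd] at h
    linear_combination h
  have hFσ : ∀ x y, F (σ y * σ x) = F (y * x) := by
    intro x y
    have h1 := heq (σ x) y
    have h2 := heq y x
    rw [hodd] at h1
    linear_combination h1 + h2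
  have heven : ∀ x, F (σ x) = F x := by
    rcases hmor with hσ | hσ
    · have hprop : ∀ x y, f x * (F y - F (σ y)) = f y * (F x - F (σ x)) := by
        intro x y
        have h1 := key x y
        have h2 := key' (σ x) y
        have h3 := hodd (σ y * x)
        rw [hσ, hinv] at h3
        rw [h3, hodd] at h2
        linear_combination -h1 - h2
      by_cases hD : F w - F (σ w) = 0
      · intro x
        refine mul_left_cancel₀ hw ?_
        linear_combination hprop x w - f x * hD
      · have hprod : ∀ x y, f (x * y) = 0 := by
          intro x y
          have h := hprop (x * y) w
          rw [hσ, hFσ, sub_self, mul_zero] at h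
          exact (mul_eq_zero.mp h).resolve_right hD
        intro x
        simp [hFdef, hprod]
    · have assoc : ∀ x y v, f y * (m * F (x * v) - F x * F v)
          = f v * (m * F (x * y) - F (σ x) * F (σ y)) := by
        intro x y v
        have h1 := key' (x * v) y
        have h2 := key' v (y * x)
        have h3 := key' v x
        have h4 := key' x y
        have h5 : F (σ (y * x)) = F (x * y) := by
          rw [hσ, hFσ]
        rw [h5, mul_assoc] at h2
        linear_combination m * (h2 - h1) - F (σ y) * h3 + F v * h4
      have hFF : ∀ x y, F x * F y = F (σ x) * F (σ y) := by
        intro x y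
        by_cases hy : f y = 0
        · have h1 := assoc x y w
          have h2 := assoc (σ x) (σ y) w
          rw [hodd, hFσ, hinv, hinv] at h2
          rw [hy] at h1 h2
          refine mul_left_cancel₀ hw ?_
          linear_combination h2 - h1
        · refine mul_left_cancel₀ hy ?_
          linear_combination -assoc x y y
      by_cases h0 : ∀ x, F x = 0
      · simp [h0]
      · obtain ⟨v, hv⟩ := not_forall.mp h0
        have hsq : (F (σ v) - F v) * (F (σ v) + F v) = 0 := by
          linear_combination -hFF v v
        rcases mul_eq_zero.mp hsq with h | h
        · intro x
          refine mul_left_cancel₀ hv ?_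
          linear_combination -hFF x v - F (σ x) * h
        · refine absurd (fun x => mul_left_cancel₀ hv ?_) hnot
          linear_combination hFF x v + F (σ x) * h
  intro x y
  rw [hg, hg]
  field_simp
  linear_combination key' y x + f y * heven x
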